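/- Let p be a subadditive measure on a set A. If the cardinal Card(A) is not g-sequential, then there exists a countable subset B ⊆ A such that p(A ∖ B) = 0. -/

import Mathlib

open Filter Topology Set

/-- A subadditive measure on a set `A`. -/
def IsSubadditiveMeasure {A : Type*} (p : Set A → ℝ) : Prop :=
  (∀ B : Set A, 0 ≤ p B ∧ p B ≤ 1) ∧
  (∀ B C : Set A, Disjoint B C → p (B ∪ C) ≤ p B + p C) ∧
  (∀ S : ℕ → Set A, (∀ n, S (n + 1) ⊆ S n) → (⋂ n, S n) = ∅ →
    Tendsto (fun n => p (S n)) atTop (𝓝 0))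

/-- `Card(A)` is a g-sequential cardinal. -/
def GSequentialCard (A : Type*) : Prop :=
  ∃ p : Set A → ℝ, IsSubadditiveMeasure p ∧ p Set.univ = 1 ∧
    ∀ F : Set A, F.Finite → p F = 0

/-- `c` bounds `p (X \ F)` for all sufficiently large countable sets `F`. -/
def IsEssBound {A : Type*} (p : Set A → ℝ) (X : Set A) (c : ℝ) : Prop :=
  0 ≤ c ∧ ∃ F : Set A, F.Countable ∧ ∀ G : Set A, G.Countable → F ⊆ G → p (X \ G) ≤ c

/-- The upper limit of `p (X \ F)` as `F` runs through the directed set of countable sets. -/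
noncomputable def essLimsup {A : Type*} (p : Set A → ℝ) (X : Set A) : ℝ :=
  sInf {c | IsEssBound p X c}

theorem bddBelow_isEssBound {A : Type*} (p : Set A → ℝ) (X : Set A) :
    BddBelow {c | IsEssBound p X c} :=
  ⟨0, fun _ hc => hc.1⟩

theorem essLimsup_le {A : Type*} {p : Set A → ℝ} {X : Set A} {c : ℝ} (h : IsEssBound p X c) :
    essLimsup p X ≤ c :=
  csInf_le (bddBelow_isEssBound p X) h

theorem essLimsup_nonneg {A : Type*} (p : Set A → ℝ) (X : Set A) : 0 ≤ essLimsup p X :=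
  Real.sInf_nonneg fun _ hc => hc.1

theorem IsSubadditiveMeasure.empty {A : Type*} {p : Set A → ℝ} (hp : IsSubadditiveMeasure p) :
    p ∅ = 0 :=
  tendsto_nhds_unique tendsto_const_nhds
    (hp.2.2 (fun _ => ∅) (fun _ => subset_rfl) (iInter_const ∅))

theorem IsSubadditiveMeasure.isEssBound_one {A : Type*} {p : Set A → ℝ}
    (hp : IsSubadditiveMeasure p) (X : Set A) : IsEssBound p X 1 :=
  ⟨zero_le_one, ∅, countable_empty, fun _ _ _ => (hp.1 _).2⟩

theorem IsSubadditiveMeasure.isEssBound_of_lt {A : Type*} {p : Set A → ℝ}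
    (hp : IsSubadditiveMeasure p) {X : Set A} {c : ℝ} (h : essLimsup p X < c) :
    IsEssBound p X c := by
  obtain ⟨d, ⟨hd, F, hF, hFd⟩, hdc⟩ := exists_lt_of_csInf_lt ⟨1, hp.isEssBound_one X⟩ h
  exact ⟨hd.trans hdc.le, F, hF, fun G hG hFG => (hFd G hG hFG).trans hdc.le⟩

theorem IsSubadditiveMeasure.essLimsup_of_countable {A : Type*} {p : Set A → ℝ}
    (hp : IsSubadditiveMeasure p) {X : Set A} (hX : X.Countable) : essLimsup p X = 0 := by
  refine le_antisymm (essLimsup_le ⟨le_rfl, X, hX, fun G _ hXG => ?_⟩) (essLimsup_nonneg p X)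
  rw [sdiff_eq_empty.2 hXG, hp.empty]

theorem IsSubadditiveMeasure.isSubadditiveMeasure_essLimsup {A : Type*} {p : Set A → ℝ}
    (hp : IsSubadditiveMeasure p) : IsSubadditiveMeasure (essLimsup p) := by
  refine ⟨fun B => ⟨essLimsup_nonneg p B, essLimsup_le (hp.isEssBound_one B)⟩, ?_, ?_⟩
  · intro B C hBC
    refine le_of_forall_pos_le_add fun ε hε => ?_
    obtain ⟨hb, F, hF, hFb⟩ := hp.isEssBound_of_lt
      (show essLimsup p B < essLimsup p B + ε / 2 by linarith)
    obtain ⟨hc, G, hG, hGc⟩ := hp.isEssBound_of_lt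
      (show essLimsup p C < essLimsup p C + ε / 2 by linarith)
    refine essLimsup_le ⟨by linarith, F ∪ G, hF.union hG, fun H hH hFGH => ?_⟩
    have h := hp.2.1 (B \ H) (C \ H) (hBC.mono sdiff_subset sdiff_subset)
    have hB := hFb H hH (subset_union_left.trans hFGH)
    have hC := hGc H hH (subset_union_right.trans hFGH)
    rw [union_sdiff_distrib]
    linarith
  · intro S hS hS0
    have hSanti : Antitone S := antitone_nat_of_succ_le hS
    by_contra hlim
    obtain ⟨ε, hε, hfreq⟩ : ∃ ε > 0, ∀ N, ∃ n ≥ N, ε ≤ essLimsup p (S n) := by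
      rw [Metric.tendsto_atTop] at hlim
      push Not at hlim
      simpa only [Real.dist_eq, sub_zero, abs_of_nonneg (essLimsup_nonneg p _)] using hlim
    have step : ∀ (N : ℕ) (F : Set A), F.Countable →
        ∃ (n : ℕ) (G : Set A), N ≤ n ∧ G.Countable ∧ F ⊆ G ∧ ε / 2 < p (S n \ G) := by
      intro N F hF
      obtain ⟨n, hn, hεn⟩ := hfreq N
      by_contra! hcon
      have := essLimsup_le (p := p) (X := S n)
        ⟨(half_pos hε).le, F, hF, fun G hG hFG => hcon n G hn hG hFG⟩
      linarith
    choose! n G hn hG hFG hp' using step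
    let u : ℕ → ℕ × Set A := fun k =>
      Nat.rec (0, ∅) (fun _ v => (n (v.1 + 1) v.2, G (v.1 + 1) v.2)) k
    have hu : ∀ k, (u k).2.Countable := by
      intro k
      induction k with
      | zero => exact countable_empty
      | succ k ih => exact hG _ _ ih
    have hle : ∀ k, k ≤ (u k).1 := by
      intro k
      induction k with
      | zero => exact le_rfl
      | succ k ih => exact (Nat.succ_le_succ ih).trans (hn _ _ (hu k))
    have hT := hp.2.2 (fun k => S (u k).1 \ (u k).2)
      (fun k => sdiff_subset_sdiff
        (hSanti ((Nat.le_succ _).trans (hn ((u k).1 + 1) _ (hu k)))) (hFG _ _ (hu k)))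
      (subset_empty_iff.1 (hS0 ▸ iInter_mono fun k => sdiff_subset.trans (hSanti (hle k))))
    obtain ⟨k, hk⟩ := ((hT.comp (tendsto_add_atTop_nat 1)).eventually_lt_const
      (half_pos hε)).exists
    exact lt_asymm hk (hp' ((u k).1 + 1) _ (hu k))

theorem IsSubadditiveMeasure.min_div_one {A : Type*} {p : Set A → ℝ}
    (hp : IsSubadditiveMeasure p) {c : ℝ} (hc : 0 < c) :
    IsSubadditiveMeasure fun X => min (p X / c) 1 := by
  have h0 : ∀ X, 0 ≤ p X / c := fun X => div_nonneg (hp.1 X).1 hc.le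
  refine ⟨fun B => ⟨le_min (h0 B) zero_le_one, min_le_right _ _⟩, fun B C hBC => ?_,
    fun S hS hS0 => ?_⟩
  · have h : p (B ∪ C) / c ≤ p B / c + p C / c := by
      rw [← add_div]
      exact div_le_div_of_nonneg_right (hp.2.1 B C hBC) hc.le
    have hB := h0 B
    have hC := h0 C
    grind
  · simpa using ((hp.2.2 S hS hS0).div_const c).min (tendsto_const_nhds (x := (1 : ℝ)))

/-- if `p` is a subadditive measure on `A` and `Card(A)` is not g-sequential,
then there is a countable `B ⊆ A` with `p(A ∖ B) = 0`. -/
theorem exists_countable_conull {A : Type*} (p : Set A → ℝ)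
    (hp : IsSubadditiveMeasure p) (hA : ¬ GSequentialCard A) :
    ∃ B : Set A, B.Countable ∧ p Bᶜ = 0 := by
  have hz : essLimsup p univ = 0 := by
    by_contra hne
    have hpos := (essLimsup_nonneg p univ).lt_of_ne' hne
    refine hA ⟨_, hp.isSubadditiveMeasure_essLimsup.min_div_one hpos, ?_, fun F hF => ?_⟩
    · simp [hne]
    · simp [hp.essLimsup_of_countable hF.countable]
  have hb : ∀ n : ℕ, IsEssBound p univ (1 / ((n : ℝ) + 1)) := fun n =>
    hp.isEssBound_of_lt (hz ▸ Nat.one_div_pos_of_nat)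
  choose _ F hF hFb using hb
  refine ⟨⋃ n, F n, countable_iUnion hF, le_antisymm ?_ (hp.1 _).1⟩
  refine ge_of_tendsto' tendsto_one_div_add_atTop_nhds_zero_nat fun n => ?_
  rw [compl_eq_univ_sdiff]
  exact hFb n _ (countable_iUnion hF) (subset_iUnion F n)
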